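/- arXiv:2004.02163 — 8 statements merged into one kernel-verified Lean document; each statement's English description precedes it below -/
import Mathlib

section
/- Let B be an n×n real symmetric positive definite matrix and let Z be an n×n real symmetric matrix satisfying Z B⁻¹ Z = Z. Then for every vector v ∈ ℝⁿ and every real ω, ‖(I − ω B⁻¹ Z) v‖_B² = ‖v‖_B² − ω(2 − ω) · vᵀ Z v. -/
open Matrix

/-- A symmetric matrix defines a symmetric bilinear form. -/
theorem Matrix.IsSymm.dotProduct_mulVec_comm {m R : Type*} [Fintype m] [CommSemiring R]
    {A : Matrix m m R} (hA : A.IsSymm) (x y : m → R) : x ⬝ᵥ A *ᵥ y = y ⬝ᵥ A *ᵥ x := by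
  rw [dotProduct_mulVec, ← mulVec_transpose, hA.eq, dotProduct_comm]

/-- Lemma 2 (Lemma 4.7 of Richtárik–Takáč): for a symmetric positive definite `B`
and a symmetric `Z` with `Z B⁻¹ Z = Z`, the `B`-norm identity
`‖(I − ω B⁻¹ Z) v‖_B² = ‖v‖_B² − ω(2 − ω) vᵀ Z v` holds. -/
theorem stmt_0 {n : ℕ} (B Z : Matrix (Fin n) (Fin n) ℝ)
    (hB : B.PosDef) (hZsymm : Z.IsSymm) (hZBZ : Z * B⁻¹ * Z = Z)
    (v : Fin n → ℝ) (ω : ℝ) :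
    ((1 : Matrix (Fin n) (Fin n) ℝ) - ω • (B⁻¹ * Z)).mulVec v ⬝ᵥ
        B.mulVec (((1 : Matrix (Fin n) (Fin n) ℝ) - ω • (B⁻¹ * Z)).mulVec v)
      = v ⬝ᵥ B.mulVec v - ω * (2 - ω) * (v ⬝ᵥ Z.mulVec v) := by
  have hBsymm : B.IsSymm := by simpa using hB.isHermitian
  have hBw : B *ᵥ ((B⁻¹ * Z) *ᵥ v) = Z *ᵥ v := by
    rw [mulVec_mulVec, mul_nonsing_inv_cancel_left _ _ hB.det_pos.ne'.isUnit]
  have hZw : Z *ᵥ ((B⁻¹ * Z) *ᵥ v) = Z *ᵥ v := by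
    rw [mulVec_mulVec, ← Matrix.mul_assoc, hZBZ]
  have hwB : ((B⁻¹ * Z) *ᵥ v) ⬝ᵥ B *ᵥ v = v ⬝ᵥ Z *ᵥ v := by
    rw [hBsymm.dotProduct_mulVec_comm, hBw]
  have hwZ : ((B⁻¹ * Z) *ᵥ v) ⬝ᵥ Z *ᵥ v = v ⬝ᵥ Z *ᵥ v := by
    rw [hZsymm.dotProduct_mulVec_comm, hZw]
  simp only [sub_mulVec, one_mulVec, smul_mulVec, mulVec_sub, mulVec_smul, hBw,
    sub_dotProduct, dotProduct_sub, smul_dotProduct, dotProduct_smul, hwB, hwZ, smul_eq_mul]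
  ring
end

section
/- Let K₁, K₂ ≥ 0 with K₁ + K₂ ≤ 1, and let δ and δ_a be positive integers with δ ≤ δ_a. If x > 0 satisfies x^{δ+1} = K₁ x^{δ} + K₂ and y > 0 satisfies y^{δ_a+1} = K₁ y^{δ_a} + K₂, then x ≤ y. (Equivalently, the unique positive root ϱ(δ) of γ^{δ+1} − K₁ γ^{δ} − K₂ is nondecreasing in the delay δ: ϱ(δ) ≤ ϱ(δ_a).) -/
/-- Lemma 13 of the paper: the unique positive root of
`γ^{δ+1} − K₁ γ^{δ} − K₂` is nondecreasing in the delay `δ`. -/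
theorem stmt_10 (K₁ K₂ : ℝ) (hK₁ : 0 ≤ K₁) (hK₂ : 0 ≤ K₂) (hsum : K₁ + K₂ ≤ 1)
    (δ δa : ℕ) (hδ : 1 ≤ δ) (hδa : 1 ≤ δa) (hle : δ ≤ δa)
    (x y : ℝ) (hx : 0 < x) (hy : 0 < y)
    (hxroot : x ^ (δ + 1) = K₁ * x ^ δ + K₂)
    (hyroot : y ^ (δa + 1) = K₁ * y ^ δa + K₂) :
    x ≤ y := by
  have hx' : x ^ δ * (x - K₁) = K₂ := by rw [pow_succ] at hxroot; linarith
  have hy' : y ^ δa * (y - K₁) = K₂ := by rw [pow_succ] at hyroot; linarith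
  have hyK : 0 ≤ y - K₁ := nonneg_of_mul_nonneg_right (hy'.symm ▸ hK₂) (pow_pos hy δa)
  have hy1 : y ≤ 1 := by
    by_contra! h
    have := le_mul_of_one_le_left hyK (one_le_pow₀ h.le (n := δa))
    linarith
  by_contra! hyx
  have h₁ : y ^ δ * (y - K₁) < y ^ δ * (x - K₁) :=
    mul_lt_mul_of_pos_left (by linarith) (pow_pos hy δ)
  have h₂ : y ^ δ * (x - K₁) ≤ x ^ δ * (x - K₁) :=
    mul_le_mul_of_nonneg_right (pow_le_pow_left₀ hy.le hyx.le δ) (by linarith)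
  have h₃ : y ^ δa * (y - K₁) ≤ y ^ δ * (y - K₁) :=
    mul_le_mul_of_nonneg_right (pow_le_pow_of_le_one hy.le hy1 hle) hyK
  linarith
end

section
/- Let δ ≥ 1 be an integer and K₁, K₂ ≥ 0. If γ ∈ (0, 1] satisfies γ^{δ+1} − K₁ γ^{δ} − K₂ = 0, then (1 − K₁ + 1/δ) γ^{δ} ≤ K₂ + 1/δ. In particular, if 1 − K₁ + 1/δ > 0, every root of p_δ(γ) := γ^{δ+1} − K₁ γ^{δ} − K₂ lying in (0,1] is at most u := ((K₂ + 1/δ)/(1 − K₁ + 1/δ))^{1/δ}. -/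
/-- The weighted AM-GM inequality `x ^ n ≤ (n * x ^ (n + 1) + 1) / (n + 1)`, cleared of
denominators. -/
theorem add_one_mul_pow_le_mul_pow_succ_add_one {x : ℝ} (hx : 0 ≤ x) (n : ℕ) :
    ((n : ℝ) + 1) * x ^ n ≤ n * x ^ (n + 1) + 1 := by
  induction n with
  | zero => simp
  | succ n ih =>
    have h : 0 ≤ ((n : ℝ) + 1) * x ^ n * (x - 1) ^ 2 := by positivity
    push_cast
    linear_combination ih + h

/-- Lemma 15 of the paper: if `γ ∈ (0,1]` is a root of
`γ^{δ+1} − K₁ γ^{δ} − K₂`, then `(1 − K₁ + 1/δ) γ^{δ} ≤ K₂ + 1/δ`; in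
particular, if `1 − K₁ + 1/δ > 0` then
`γ ≤ ((K₂ + 1/δ)/(1 − K₁ + 1/δ))^{1/δ}`. -/
theorem stmt_12 (δ : ℕ) (hδ : 1 ≤ δ) (K₁ K₂ : ℝ) (hK₁ : 0 ≤ K₁) (hK₂ : 0 ≤ K₂)
    (γ : ℝ) (hγ0 : 0 < γ) (hγ1 : γ ≤ 1)
    (hroot : γ ^ (δ + 1) - K₁ * γ ^ δ - K₂ = 0) :
    (1 - K₁ + 1 / (δ : ℝ)) * γ ^ δ ≤ K₂ + 1 / (δ : ℝ) ∧
      (0 < 1 - K₁ + 1 / (δ : ℝ) →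
        γ ≤ ((K₂ + 1 / (δ : ℝ)) / (1 - K₁ + 1 / (δ : ℝ))) ^ (((δ : ℝ))⁻¹)) := by
  have hδ0 : (0 : ℝ) < δ := by exact_mod_cast hδ
  have hbound : (1 - K₁ + 1 / (δ : ℝ)) * γ ^ δ ≤ K₂ + 1 / (δ : ℝ) := by
    have h : (1 + 1 / (δ : ℝ)) * γ ^ δ ≤ γ ^ (δ + 1) + 1 / (δ : ℝ) := by
      have h := add_one_mul_pow_le_mul_pow_succ_add_one hγ0.le δ
      field_simp
      linarith
    linear_combination h + hroot
  refine ⟨hbound, fun hpos => ?_⟩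
  rw [Real.le_rpow_inv_iff_of_pos hγ0.le (by positivity) hδ0, Real.rpow_natCast,
    le_div_iff₀' hpos]
  exact hbound
end

section
/- Let λ ∈ (0, 1) and d > 0. Define U(θ) := (θ(1 + (1−θ)λ) + 1/d)/(θ(2−θ)λ) for θ ∈ (0, 1], and let θ₁ := (√(1 + 2d(1−λ)) − 1)/(d(1−λ)). Then θ₁ ∈ (0, 1] and U(θ₁) ≤ U(θ) for all θ ∈ (0, 1]; that is, θ₁ minimizes U over (0, 1]. -/
/-- For `λ ∈ (0,1)`, `d > 0`, the quantity
`U(θ) = (θ(1+(1−θ)λ)+1/d)/(θ(2−θ)λ)` is minimized over `θ ∈ (0,1]` at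
`θ₁ = (√(1+2d(1−λ))−1)/(d(1−λ))`, which lies in `(0,1]`. -/
theorem stmt_14 (lam d : ℝ) (hlam0 : 0 < lam) (hlam1 : lam < 1) (hd : 0 < d)
    (U : ℝ → ℝ)
    (hU : ∀ θ : ℝ, U θ = (θ * (1 + (1 - θ) * lam) + 1 / d) / (θ * (2 - θ) * lam))
    (θ₁ : ℝ) (hθ₁ : θ₁ = (Real.sqrt (1 + 2 * d * (1 - lam)) - 1) / (d * (1 - lam))) :
    0 < θ₁ ∧ θ₁ ≤ 1 ∧ ∀ θ : ℝ, 0 < θ → θ ≤ 1 → U θ₁ ≤ U θ := by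
  have ha : 0 < 1 - lam := by linarith
  have hda : 0 < d * (1 - lam) := mul_pos hd ha
  have hs : Real.sqrt (1 + 2 * d * (1 - lam)) ^ 2 = 1 + 2 * d * (1 - lam) :=
    Real.sq_sqrt (by nlinarith)
  have hs1 : 1 < Real.sqrt (1 + 2 * d * (1 - lam)) :=
    Real.lt_sqrt_of_sq_lt (by nlinarith)
  generalize Real.sqrt (1 + 2 * d * (1 - lam)) = s at hs hs1 hθ₁
  have hpos : 0 < θ₁ := by
    rw [hθ₁]
    exact div_pos (by linarith) hda
  have hquad : d * (1 - lam) * θ₁ ^ 2 = 2 * (1 - θ₁) := by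
    rw [hθ₁]
    field_simp
    linear_combination hs
  have hlt : θ₁ < 1 := by
    have : 0 < d * (1 - lam) * θ₁ ^ 2 := by positivity
    linarith
  refine ⟨hpos, hlt.le, fun θ h0 h1 ↦ ?_⟩
  have hinv : 1 / d = (1 - lam) * θ₁ ^ 2 / (2 * (1 - θ₁)) := by
    rw [← hquad]
    field_simp
  have h1t : 0 < 1 - θ₁ := by linarith
  have h2t : 0 < 2 - θ₁ := by linarith
  have h2θ : 0 < 2 - θ := by linarith
  have hdiff : U θ - U θ₁ =
      (1 - lam) * (θ - θ₁) ^ 2 / (2 * (1 - θ₁) * (θ * (2 - θ) * lam)) := by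
    rw [hU, hU, hinv]
    field_simp
    ring
  rw [← sub_nonneg, hdiff]
  positivity
end

section
/- Let λ > 0 and d > 0. Define U₂(θ) := (θ(1 + 2(1−θ)λ) + 1/d)/(4θ(1−θ)λ) for θ ∈ (0, 1), and let θ₂ := (√(d+1) − 1)/d. Then θ₂ ∈ (0, 1), U₂(θ₂) ≤ U₂(θ) for all θ ∈ (0, 1), and U₂(θ₂) = (1/4 + λ/2 + (1 + √(d+1))/(2d))/λ. -/
/-- For `λ > 0`, `d > 0`, the quantity
`U₂(θ) = (θ(1+2(1−θ)λ)+1/d)/(4θ(1−θ)λ)` is minimized over `θ ∈ (0,1)` at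
`θ₂ = (√(d+1)−1)/d ∈ (0,1)`, with minimum value
`(1/4 + λ/2 + (1+√(d+1))/(2d))/λ`. -/
theorem stmt_15 (lam d : ℝ) (hlam : 0 < lam) (hd : 0 < d)
    (U₂ : ℝ → ℝ)
    (hU₂ : ∀ θ : ℝ, U₂ θ = (θ * (1 + 2 * (1 - θ) * lam) + 1 / d) / (4 * θ * (1 - θ) * lam))
    (θ₂ : ℝ) (hθ₂ : θ₂ = (Real.sqrt (d + 1) - 1) / d) :
    0 < θ₂ ∧ θ₂ < 1 ∧ (∀ θ : ℝ, 0 < θ → θ < 1 → U₂ θ₂ ≤ U₂ θ) ∧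
      U₂ θ₂ = (1 / 4 + lam / 2 + (1 + Real.sqrt (d + 1)) / (2 * d)) / lam := by
  obtain ⟨s, hs⟩ : ∃ s, s = Real.sqrt (d + 1) := ⟨_, rfl⟩
  have hs1 : 1 < s := by
    rw [hs, Real.lt_sqrt zero_le_one]
    linarith
  have hds : d = (s - 1) * (s + 1) := by
    have h := Real.sq_sqrt (show (0 : ℝ) ≤ d + 1 by linarith)
    rw [← hs] at h
    linarith
  rw [← hs] at hθ₂ ⊢
  have hsub : 0 < s - 1 := sub_pos.mpr hs1
  have hadd : 0 < s + 1 := by linarith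
  have hθ : θ₂ = 1 / (s + 1) := by
    rw [hθ₂, hds]
    field_simp
  have hpos : 0 < θ₂ := by
    rw [hθ]
    positivity
  have hlt : θ₂ < 1 := by
    rw [hθ, div_lt_one hadd]
    linarith
  have key : ∀ θ : ℝ, 0 < θ → θ < 1 →
      U₂ θ = (1 / 4 + lam / 2 + (1 + s) / (2 * d)) / lam +
        ((s + 1) * θ - 1) ^ 2 / (4 * θ * (1 - θ) * lam * d) := by
    intro θ h0 h1
    have h2 : 1 - θ ≠ 0 := (sub_pos.mpr h1).ne'
    rw [hU₂, hds]
    field_simp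
    ring
  have hval : U₂ θ₂ = (1 / 4 + lam / 2 + (1 + s) / (2 * d)) / lam := by
    have hroot : (s + 1) * θ₂ - 1 = 0 := by
      rw [hθ, mul_one_div_cancel hadd.ne', sub_self]
    rw [key θ₂ hpos hlt, hroot]
    simp
  refine ⟨hpos, hlt, fun θ h0 h1 => ?_, hval⟩
  rw [hval, key θ h0 h1]
  have h2 : 0 < 1 - θ := sub_pos.mpr h1
  exact le_add_of_nonneg_right (by positivity)
end

section
/- Let d ≥ 4 be real and λ ∈ (0, 1/2]. Then 1/4 + λ/2 + (1 + √(d+1))/(2d) ≤ 3/4 + (1 + √(1 + 2d(1−λ)))/(4d) ≤ 1 + 1/d. Consequently, dividing by λ, the three quantities (1/4 + λ/2 + (1+√(d+1))/(2d))/λ, (3/4 + (1+√(1+2d(1−λ)))/(4d))/λ and (1 + 1/d)/λ — which the paper denotes U(θ₂,2), U(θ₁,1) and U(1,1) respectively — satisfy U(θ₂,2) ≤ U(θ₁,1) ≤ U(1,1). -/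
/-- Lemma 18 of the paper: for `d ≥ 4` and `λ ∈ (0, 1/2]`,
`1/4 + λ/2 + (1+√(d+1))/(2d) ≤ 3/4 + (1+√(1+2d(1−λ)))/(4d) ≤ 1 + 1/d`, and
consequently, dividing by `λ`, `U(θ₂,2) ≤ U(θ₁,1) ≤ U(1,1)`. -/
theorem stmt_16 (d lam : ℝ) (hd : 4 ≤ d) (hlam0 : 0 < lam) (hlam1 : lam ≤ 1 / 2) :
    (1 / 4 + lam / 2 + (1 + Real.sqrt (d + 1)) / (2 * d) ≤
        3 / 4 + (1 + Real.sqrt (1 + 2 * d * (1 - lam))) / (4 * d)) ∧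
      (3 / 4 + (1 + Real.sqrt (1 + 2 * d * (1 - lam))) / (4 * d) ≤ 1 + 1 / d) ∧
      ((1 / 4 + lam / 2 + (1 + Real.sqrt (d + 1)) / (2 * d)) / lam ≤
        (3 / 4 + (1 + Real.sqrt (1 + 2 * d * (1 - lam))) / (4 * d)) / lam) ∧
      ((3 / 4 + (1 + Real.sqrt (1 + 2 * d * (1 - lam))) / (4 * d)) / lam ≤
        (1 + 1 / d) / lam) := by
  have hd0 : 0 < d := by linarith
  have hA2 : 2 ≤ √(d + 1) := Real.le_sqrt_of_sq_le (by linarith)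
  have hAB : √(d + 1) ≤ √(1 + 2 * d * (1 - lam)) := Real.sqrt_le_sqrt (by nlinarith)
  have hBsq : √(1 + 2 * d * (1 - lam)) ^ 2 = 1 + 2 * d * (1 - lam) :=
    Real.sq_sqrt (by nlinarith)
  have hBd : √(1 + 2 * d * (1 - lam)) ≤ d + 3 :=
    Real.sqrt_le_iff.mpr ⟨by linarith, by nlinarith [mul_pos hd0 hlam0]⟩
  set A := √(d + 1)
  set B := √(1 + 2 * d * (1 - lam))
  have h₁ : 1 / 4 + lam / 2 + (1 + A) / (2 * d) ≤ 3 / 4 + (1 + B) / (4 * d) := by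
    rw [← sub_nonneg]
    have hdiff : 3 / 4 + (1 + B) / (4 * d) - (1 / 4 + lam / 2 + (1 + A) / (2 * d)) =
        (2 * d * (1 - lam) + B - 1 - 2 * A) / (4 * d) := by
      field_simp
      ring
    rw [hdiff]
    exact div_nonneg (by nlinarith) (by linarith)
  have h₂ : 3 / 4 + (1 + B) / (4 * d) ≤ 1 + 1 / d := by
    rw [← sub_nonneg]
    have hdiff : 1 + 1 / d - (3 / 4 + (1 + B) / (4 * d)) = (d + 3 - B) / (4 * d) := by
      field_simp
      ring
    rw [hdiff]
    exact div_nonneg (by linarith) (by linarith)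
  exact ⟨h₁, h₂, div_le_div_of_nonneg_right h₁ hlam0.le, div_le_div_of_nonneg_right h₂ hlam0.le⟩
end

section
/- Let 0 < λ_min ≤ λ_max with λ_min + λ_max ≤ 1, suppose 1/4 + λ_min/2 < λ_max, and let c > 0. For τ > 0 define χ_a(τ) := (1/4 + λ_min/2 + (1 + √(cτ + 1))/(2cτ))/λ_min and χ_s(τ) := (λ_max + (1 − λ_max)/τ)/λ_min. Then χ_a(τ) → (1/4 + λ_min/2)/λ_min and χ_s(τ) → λ_max/λ_min as τ → ∞, the first limit is strictly smaller than the second, and there exists τ₀ > 0 such that χ_a(τ) < χ_s(τ) for all τ ≥ τ₀. -/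
open Filter

theorem tendsto_one_add_sqrt_div_atTop :
    Tendsto (fun x : ℝ => (1 + Real.sqrt (x + 1)) / (2 * x)) atTop (nhds 0) := by
  have h : Tendsto (fun x : ℝ => 2 * (Real.sqrt (x + 1) - 1)) atTop atTop :=
    (tendsto_atTop_add_const_right _ (-1) (Real.tendsto_sqrt_atTop.comp
      (tendsto_atTop_add_const_right _ 1 tendsto_id))).const_mul_atTop two_pos
  refine h.inv_tendsto_atTop.congr' ?_
  filter_upwards [eventually_gt_atTop 0] with x hx
  have hs : Real.sqrt (x + 1) ^ 2 = x + 1 := Real.sq_sqrt (by linarith)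
  have hs1 : 1 < Real.sqrt (x + 1) := Real.lt_sqrt_of_sq_lt (by linarith)
  have hne : Real.sqrt (x + 1) - 1 ≠ 0 := by linarith
  simp only [Pi.inv_apply]
  field_simp
  linear_combination -hs

/-- Asymptotic comparison (Section 4.3, Case 2): with
`χ_a(τ) = (1/4 + λ_min/2 + (1+√(cτ+1))/(2cτ))/λ_min` and
`χ_s(τ) = (λ_max + (1−λ_max)/τ)/λ_min`, one has
`χ_a → (1/4 + λ_min/2)/λ_min`, `χ_s → λ_max/λ_min` as `τ → ∞`, the first limit
is strictly smaller, and `χ_a(τ) < χ_s(τ)` for all sufficiently large `τ`. -/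
theorem stmt_18 (lammin lammax c : ℝ) (h0 : 0 < lammin) (h1 : lammin ≤ lammax)
    (h2 : lammin + lammax ≤ 1) (h3 : 1 / 4 + lammin / 2 < lammax) (hc : 0 < c)
    (χa χs : ℝ → ℝ)
    (hχa : ∀ τ : ℝ, 0 < τ →
      χa τ = (1 / 4 + lammin / 2 + (1 + Real.sqrt (c * τ + 1)) / (2 * (c * τ))) / lammin)
    (hχs : ∀ τ : ℝ, 0 < τ → χs τ = (lammax + (1 - lammax) / τ) / lammin) :
    Tendsto χa atTop (nhds ((1 / 4 + lammin / 2) / lammin)) ∧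
      Tendsto χs atTop (nhds (lammax / lammin)) ∧
      (1 / 4 + lammin / 2) / lammin < lammax / lammin ∧
      ∃ τ₀ : ℝ, 0 < τ₀ ∧ ∀ τ : ℝ, τ₀ ≤ τ → χa τ < χs τ := by
  have ha : Tendsto χa atTop (nhds ((1 / 4 + lammin / 2) / lammin)) := by
    have h := ((tendsto_one_add_sqrt_div_atTop.comp
      (tendsto_id.const_mul_atTop hc)).const_add (1 / 4 + lammin / 2)).div_const lammin
    rw [add_zero] at h
    refine h.congr' ?_
    filter_upwards [eventually_gt_atTop 0] with τ hτ
    exact (hχa τ hτ).symm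
  have hs : Tendsto χs atTop (nhds (lammax / lammin)) := by
    have h := ((tendsto_id.const_div_atTop (1 - lammax)).const_add lammax).div_const lammin
    rw [add_zero] at h
    refine h.congr' ?_
    filter_upwards [eventually_gt_atTop 0] with τ hτ
    exact (hχs τ hτ).symm
  have hlt : (1 / 4 + lammin / 2) / lammin < lammax / lammin := by gcongr
  obtain ⟨τ₀, hτ₀⟩ := eventually_atTop.1 (ha.eventually_lt hs hlt)
  exact ⟨ha, hs, hlt, max τ₀ 1, by positivity, fun τ hτ => hτ₀ τ ((le_max_left _ _).trans hτ)⟩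
end

section
/- Let 0 < λ_min < λ_max ≤ 1 with k := λ_min + λ_max ≥ 1, and let c > 0. For τ > 0 define χ_a(τ) := ((3λ_min + λ_max)/4 + (√(1 + cτ(2−k)) + 2(cτ + 1 + cτ(1−k)λ_min))/(2cτ√(1 + cτ(2−k))))/λ_min and χ_s(τ) := (λ_max + (1 − λ_max)/τ)/λ_min. Then χ_a(τ) → (3λ_min + λ_max)/(4λ_min) and χ_s(τ) → λ_max/λ_min as τ → ∞, the first limit is strictly smaller than the second, and there exists τ₀ > 0 such that χ_a(τ) < χ_s(τ) for all τ ≥ τ₀. -/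
open Filter

/-- Asymptotic comparison (Section 4.3, Case 1): with `k = λ_min + λ_max ≥ 1`,
`χ_a(τ) = ((3λ_min+λ_max)/4 + (√(1+cτ(2−k)) + 2(cτ+1+cτ(1−k)λ_min))/(2cτ√(1+cτ(2−k))))/λ_min`
and `χ_s(τ) = (λ_max + (1−λ_max)/τ)/λ_min`, one has
`χ_a → (3λ_min+λ_max)/(4λ_min)`, `χ_s → λ_max/λ_min` as `τ → ∞`, the first
limit is strictly smaller, and `χ_a(τ) < χ_s(τ)` for all sufficiently large `τ`. -/
theorem stmt_19 (lammin lammax c k : ℝ) (h0 : 0 < lammin) (h1 : lammin < lammax)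
    (h2 : lammax ≤ 1) (hk : k = lammin + lammax) (hk1 : 1 ≤ k) (hc : 0 < c)
    (χa χs : ℝ → ℝ)
    (hχa : ∀ τ : ℝ, 0 < τ →
      χa τ = ((3 * lammin + lammax) / 4 +
          (Real.sqrt (1 + c * τ * (2 - k)) +
              2 * (c * τ + 1 + c * τ * (1 - k) * lammin)) /
            (2 * (c * τ) * Real.sqrt (1 + c * τ * (2 - k)))) / lammin)
    (hχs : ∀ τ : ℝ, 0 < τ → χs τ = (lammax + (1 - lammax) / τ) / lammin) :
    Tendsto χa atTop (nhds ((3 * lammin + lammax) / (4 * lammin))) ∧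
      Tendsto χs atTop (nhds (lammax / lammin)) ∧
      (3 * lammin + lammax) / (4 * lammin) < lammax / lammin ∧
      ∃ τ₀ : ℝ, 0 < τ₀ ∧ ∀ τ : ℝ, τ₀ ≤ τ → χa τ < χs τ := by
  have hk2 : 0 < 2 - k := by linarith
  have hcτ : Tendsto (fun τ : ℝ => c * τ) atTop atTop := tendsto_id.const_mul_atTop hc
  have hinv : Tendsto (fun τ : ℝ => (c * τ)⁻¹) atTop (nhds 0) :=
    tendsto_inv_atTop_zero.comp hcτ
  have hsqrt : Tendsto (fun τ : ℝ => (Real.sqrt (1 + c * τ * (2 - k)))⁻¹) atTop (nhds 0) :=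
    tendsto_inv_atTop_zero.comp (Real.tendsto_sqrt_atTop.comp
      (tendsto_atTop_add_const_left _ 1 (hcτ.atTop_mul_const hk2)))
  have ha : Tendsto χa atTop (nhds ((3 * lammin + lammax) / (4 * lammin))) := by
    have hlim : Tendsto (fun τ : ℝ => ((3 * lammin + lammax) / 4 + (1 / 2 * (c * τ)⁻¹ +
        (1 + (c * τ)⁻¹ + (1 - k) * lammin) * (Real.sqrt (1 + c * τ * (2 - k)))⁻¹)) / lammin)
        atTop (nhds (((3 * lammin + lammax) / 4 + (1 / 2 * 0 +
          (1 + 0 + (1 - k) * lammin) * 0)) / lammin)) :=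
      ((((hinv.const_mul _).add (((hinv.const_add 1).add_const _).mul hsqrt)).const_add
        _).div_const _)
    have heq : ((3 * lammin + lammax) / 4 + (1 / 2 * 0 +
        (1 + 0 + (1 - k) * lammin) * 0)) / lammin = (3 * lammin + lammax) / (4 * lammin) := by
      rw [mul_zero, mul_zero, add_zero, add_zero, div_div]
    rw [heq] at hlim
    refine hlim.congr' ?_
    filter_upwards [eventually_gt_atTop 0] with τ hτ
    have hs : 0 < Real.sqrt (1 + c * τ * (2 - k)) := by positivity
    rw [hχa τ hτ]
    generalize Real.sqrt (1 + c * τ * (2 - k)) = s at hs ⊢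
    congr 2
    field_simp
  have hs : Tendsto χs atTop (nhds (lammax / lammin)) := by
    have hlim : Tendsto (fun τ : ℝ => (lammax + (1 - lammax) / τ) / lammin) atTop
        (nhds ((lammax + 0) / lammin)) :=
      ((tendsto_id.const_div_atTop _).const_add _).div_const _
    rw [add_zero] at hlim
    refine hlim.congr' ?_
    filter_upwards [eventually_gt_atTop 0] with τ hτ
    exact (hχs τ hτ).symm
  have hlt : (3 * lammin + lammax) / (4 * lammin) < lammax / lammin := by
    rw [div_lt_div_iff₀ (by positivity) h0]
    nlinarith
  refine ⟨ha, hs, hlt, ?_⟩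
  obtain ⟨τ₁, hτ₁⟩ := eventually_atTop.1 (ha.eventually_lt hs hlt)
  exact ⟨max τ₁ 1, by positivity, fun τ hτ => hτ₁ τ ((le_max_left _ _).trans hτ)⟩
end
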